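/- Let n ≥ m ≥ 1, let Σ be an m×m real positive definite matrix, ρ > 0, k ∈ ℝ and ν > 0 with ν/2 + k > 0, and τ = (t₁, …, t_m) ∈ ℝ^m with n/2 + t_i − (i−1)/2 > 0 for all i. Suppose the random n×m real matrix T has the matrix multivariate T-Riesz type I distribution MTR^I(ν, k, τ, ρ, 0, I_n, Σ) (i.e. the density of Theorem 3.1 with μ = 0 and Θ = I_n). Then F = TᵀT has, with respect to Lebesgue measure on m×m real symmetric matrices restricted to the positive definite cone, the density c · det(F)^{(n−m−1)/2} · (1 + ρ·tr(Σ^{−1}F))^{−[(mn+ν)/2 + k + Σᵢtᵢ]} · q_τ(F), where c = Γ((ν+mn)/2 + k + Σᵢtᵢ) · ρ^{mn/2 + Σᵢtᵢ} / (Γ_m(n/2, τ) · Γ(ν/2+k) · (det Σ)^{n/2} · q_τ(Σ)). F is said to have the matrix multivariate c-beta-Riesz type II distribution. -/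

import Mathlib

open MeasureTheory Matrix Real

/-- Lebesgue (product) measure on `n × m` real matrices, via the identification with `ℝ^{nm}`. -/
noncomputable instance matMeasureSpace (n m : ℕ) : MeasureSpace (Matrix (Fin n) (Fin m) ℝ) :=
  (inferInstance : MeasureSpace (Fin n → Fin m → ℝ))

/-- Determinant of the leading principal `(i+1) × (i+1)` submatrix. -/
noncomputable def princMinor {m : ℕ} (A : Matrix (Fin m) (Fin m) ℝ) (i : Fin m) : ℝ :=
  (A.submatrix (fun j : Fin (i.1 + 1) => Fin.castLE i.isLt j)
    (fun j : Fin (i.1 + 1) => Fin.castLE i.isLt j)).det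

/-- The highest weight vector (generalized power)
`q_κ(A) = det(A)^{k_m} ∏_{i=1}^{m-1} det(A_i)^{k_i - k_{i+1}}`. -/
noncomputable def hwv {m : ℕ} (κ : Fin m → ℝ) (A : Matrix (Fin m) (Fin m) ℝ) : ℝ :=
  ∏ i : Fin m, princMinor A i ^ (if h : i.1 + 1 < m then κ i - κ ⟨i.1 + 1, h⟩ else κ i)

/-- The real multivariate gamma function `Γ_m(a) = π^{m(m-1)/4} ∏ Γ(a - (i-1)/2)`. -/
noncomputable def mvGamma (m : ℕ) (a : ℝ) : ℝ :=
  Real.pi ^ (((m * (m - 1) : ℕ) : ℝ) / 4) * ∏ i : Fin m, Real.Gamma (a - (i : ℝ) / 2)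

/-- The generalized gamma function of weight `τ`:
`Γ_m(a, τ) = π^{m(m-1)/4} ∏ Γ(a + t_i - (i-1)/2)`. -/
noncomputable def mvGammaI (m : ℕ) (a : ℝ) (τ : Fin m → ℝ) : ℝ :=
  Real.pi ^ (((m * (m - 1) : ℕ) : ℝ) / 4) * ∏ i : Fin m, Real.Gamma (a + τ i - (i : ℝ) / 2)

/-- The generalized gamma function of weight `-τ`:
`Γ_m(a, -τ) = π^{m(m-1)/4} ∏ Γ(a - t_i - (m-i)/2)`. -/
noncomputable def mvGammaII (m : ℕ) (a : ℝ) (τ : Fin m → ℝ) : ℝ :=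
  Real.pi ^ (((m * (m - 1) : ℕ) : ℝ) / 4) *
    ∏ i : Fin m, Real.Gamma (a - τ i - ((m : ℝ) - 1 - (i : ℝ)) / 2)

/-- Lebesgue measure on `m × m` real symmetric matrices: the pushforward of the product
Lebesgue measure in the coordinates `(x_{ij})_{i ≤ j}` under the obvious parametrization. -/
noncomputable def symmVol (m : ℕ) : Measure (Matrix (Fin m) (Fin m) ℝ) :=
  Measure.map (fun f : {p : Fin m × Fin m // p.1 ≤ p.2} → ℝ =>
    Matrix.of fun i j => if h : i ≤ j then f ⟨(i, j), h⟩ else f ⟨(j, i), le_of_not_ge h⟩) volume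

/-- The eigenvalues of `XᵀX`, arranged in decreasing order. -/
noncomputable def sortedEigs {n m : ℕ} (X : Matrix (Fin n) (Fin m) ℝ) : Fin m → ℝ :=
  fun i =>
    ((Matrix.isHermitian_conjTranspose_mul_self X).eigenvalues ∘
      Tuple.sort (Matrix.isHermitian_conjTranspose_mul_self X).eigenvalues) (Fin.rev i)

/-- The singular values of an `n × m` real matrix, in decreasing order. -/
noncomputable def svalues {n m : ℕ} (X : Matrix (Fin n) (Fin m) ℝ) : Fin m → ℝ :=
  fun i => Real.sqrt (sortedEigs X i)
open scoped Classical

/-- The Kotz-Riesz type I density `KR^I_{n×m}(τ, μ, Θ, Σ)` (with `U = u(Σ)` the upper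
triangular Cholesky factor of `Σ`, supplied explicitly). -/
noncomputable def kotzRieszIDen (n m : ℕ) (τ : Fin m → ℝ) (μ : Matrix (Fin n) (Fin m) ℝ)
    (Θ : Matrix (Fin n) (Fin n) ℝ) (Sig U : Matrix (Fin m) (Fin m) ℝ)
    (y : Matrix (Fin n) (Fin m) ℝ) : ℝ :=
  mvGamma m ((n : ℝ) / 2) /
      (Real.pi ^ (((m * n : ℕ) : ℝ) / 2) * mvGammaI m ((n : ℝ) / 2) τ *
        Sig.det ^ ((n : ℝ) / 2) * Θ.det ^ ((m : ℝ) / 2)) *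
    Real.exp (-(Sig⁻¹ * (y - μ)ᵀ * Θ⁻¹ * (y - μ)).trace) *
    hwv τ ((Uᵀ)⁻¹ * (y - μ)ᵀ * Θ⁻¹ * (y - μ) * U⁻¹)

/-- The Kotz-Riesz type II density `KR^{II}_{n×m}(τ, μ, Θ, Σ)` (with `U = u(Σ)` the upper
triangular Cholesky factor of `Σ`, supplied explicitly). -/
noncomputable def kotzRieszIIDen (n m : ℕ) (τ : Fin m → ℝ) (μ : Matrix (Fin n) (Fin m) ℝ)
    (Θ : Matrix (Fin n) (Fin n) ℝ) (Sig U : Matrix (Fin m) (Fin m) ℝ)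
    (y : Matrix (Fin n) (Fin m) ℝ) : ℝ :=
  mvGamma m ((n : ℝ) / 2) /
      (Real.pi ^ (((m * n : ℕ) : ℝ) / 2) * mvGammaII m ((n : ℝ) / 2) τ *
        Sig.det ^ ((n : ℝ) / 2) * Θ.det ^ ((m : ℝ) / 2)) *
    Real.exp (-(Sig⁻¹ * (y - μ)ᵀ * Θ⁻¹ * (y - μ)).trace) *
    hwv τ (((Uᵀ)⁻¹ * (y - μ)ᵀ * Θ⁻¹ * (y - μ) * U⁻¹)⁻¹)

/-- The matrix multivariate T-Riesz type I density
`MTR^I(ν, k, τ, ρ, μ, Θ, Σ)` (with `U = u(Σ)` supplied explicitly). -/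
noncomputable def tRieszIDen (n m : ℕ) (ν k ρ : ℝ) (τ : Fin m → ℝ)
    (μ : Matrix (Fin n) (Fin m) ℝ) (Θ : Matrix (Fin n) (Fin n) ℝ)
    (Sig U : Matrix (Fin m) (Fin m) ℝ) (t : Matrix (Fin n) (Fin m) ℝ) : ℝ :=
  mvGamma m ((n : ℝ) / 2) * Real.Gamma ((ν + (m * n : ℕ)) / 2 + k + ∑ i, τ i) *
      ρ ^ (((m * n : ℕ) : ℝ) / 2 + ∑ i, τ i) /
      (Real.pi ^ (((m * n : ℕ) : ℝ) / 2) * mvGammaI m ((n : ℝ) / 2) τ *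
        Real.Gamma (ν / 2 + k) * Sig.det ^ ((n : ℝ) / 2) * Θ.det ^ ((m : ℝ) / 2)) *
    (1 + ρ * (Sig⁻¹ * (t - μ)ᵀ * Θ⁻¹ * (t - μ)).trace) ^
      (-((ν + (m * n : ℕ)) / 2 + k + ∑ i, τ i)) *
    hwv τ ((Uᵀ)⁻¹ * (t - μ)ᵀ * Θ⁻¹ * (t - μ) * U⁻¹)

/-- The matrix multivariate T-Riesz type II density
`MTR^{II}(ν, k, τ, ρ, μ, Θ, Σ)` (with `U = u(Σ)` supplied explicitly). -/
noncomputable def tRieszIIDen (n m : ℕ) (ν k ρ : ℝ) (τ : Fin m → ℝ)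
    (μ : Matrix (Fin n) (Fin m) ℝ) (Θ : Matrix (Fin n) (Fin n) ℝ)
    (Sig U : Matrix (Fin m) (Fin m) ℝ) (t : Matrix (Fin n) (Fin m) ℝ) : ℝ :=
  mvGamma m ((n : ℝ) / 2) * Real.Gamma ((ν + (m * n : ℕ)) / 2 - k - ∑ i, τ i) *
      ρ ^ (((m * n : ℕ) : ℝ) / 2 - ∑ i, τ i) /
      (Real.pi ^ (((m * n : ℕ) : ℝ) / 2) * mvGammaII m ((n : ℝ) / 2) τ *
        Real.Gamma (ν / 2 - k) * Sig.det ^ ((n : ℝ) / 2) * Θ.det ^ ((m : ℝ) / 2)) *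
    (1 + ρ * (Sig⁻¹ * (t - μ)ᵀ * Θ⁻¹ * (t - μ)).trace) ^
      (-((ν + (m * n : ℕ)) / 2 - k - ∑ i, τ i)) *
    hwv τ (((Uᵀ)⁻¹ * (t - μ)ᵀ * Θ⁻¹ * (t - μ) * U⁻¹)⁻¹)

/-- The symmetric `(m+1) × (m+1)` matrix with corner `a`, first row `(a, b)` and lower block `G`. -/
def borderedMatrix {m : ℕ} (a : ℝ) (b : Fin m → ℝ) (G : Matrix (Fin m) (Fin m) ℝ) :
    Matrix (Fin (m + 1)) (Fin (m + 1)) ℝ :=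
  Matrix.of (Fin.cons (Fin.cons a b) fun i => Fin.cons (b i) (G i))

/-- Index set of the free coordinates of a symmetric `m × m` matrix. -/
abbrev SymmIdx (m : ℕ) := {p : Fin m × Fin m // p.1 ≤ p.2}

/-- The symmetric matrix with the given upper triangular coordinates. -/
def symmParam (m : ℕ) (f : SymmIdx m → ℝ) : Matrix (Fin m) (Fin m) ℝ :=
  Matrix.of fun i j => if h : i ≤ j then f ⟨(i, j), h⟩ else f ⟨(j, i), le_of_not_ge h⟩

lemma measurable_symmParam (m : ℕ) : Measurable (symmParam m) := by
  refine measurable_pi_iff.2 fun i => measurable_pi_iff.2 fun j => ?_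
  by_cases h : i ≤ j
  · simpa [symmParam, h] using measurable_pi_apply _
  · simpa [symmParam, h] using measurable_pi_apply _

lemma symmVol_eq_map (m : ℕ) : symmVol m = Measure.map (symmParam m) volume := rfl

instance (m : ℕ) : SFinite (symmVol m) := by
  rw [symmVol_eq_map]; infer_instance

lemma lintegral_symmVol {m : ℕ} {g : Matrix (Fin m) (Fin m) ℝ → ENNReal} (hg : Measurable g) :
    ∫⁻ F, g F ∂symmVol m = ∫⁻ f : SymmIdx m → ℝ, g (symmParam m f) := by
  rw [symmVol_eq_map, lintegral_map hg (measurable_symmParam m)]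

instance (n m : ℕ) : BorelSpace (Matrix (Fin n) (Fin m) ℝ) :=
  inferInstanceAs (BorelSpace (Fin n → Fin m → ℝ))

/-- The coordinates of a symmetric `(m+1) × (m+1)` matrix, split off along the first row. -/
def symmIdxSuccMap (m : ℕ) : Unit ⊕ (Fin m ⊕ SymmIdx m) → SymmIdx (m + 1) :=
  Sum.elim (fun _ => ⟨(0, 0), le_rfl⟩)
    (Sum.elim (fun j => ⟨(0, j.succ), Fin.zero_le _⟩)
      (fun p => ⟨(p.1.1.succ, p.1.2.succ), Fin.succ_le_succ_iff.2 p.2⟩))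

lemma symmIdxSuccMap_bijective (m : ℕ) : Function.Bijective (symmIdxSuccMap m) := by
  constructor
  · rintro (x | x | ⟨⟨x, x'⟩, hx⟩) (y | y | ⟨⟨y, y'⟩, hy⟩) h <;>
      simp_all [symmIdxSuccMap, Fin.ext_iff]
  · rintro ⟨⟨i, j⟩, hij⟩
    induction i using Fin.cases with
    | zero =>
      induction j using Fin.cases with
      | zero => exact ⟨Sum.inl (), rfl⟩
      | succ j => exact ⟨Sum.inr (Sum.inl j), rfl⟩
    | succ i =>
      induction j using Fin.cases with
      | zero => simp at hij
      | succ j => exact ⟨Sum.inr (Sum.inr ⟨(i, j), by simpa using hij⟩), rfl⟩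

lemma lintegral_symmVol_succ {m : ℕ} {g : Matrix (Fin (m + 1)) (Fin (m + 1)) ℝ → ENNReal}
    (hg : Measurable g) :
    ∫⁻ F, g F ∂symmVol (m + 1) =
      ∫⁻ a : ℝ, ∫⁻ b : Fin m → ℝ, ∫⁻ G, g (borderedMatrix a b G) ∂symmVol m := by
  have hb : ∀ a b, Measurable fun G => g (borderedMatrix (m := m) a b G) := by
    intro a b
    refine hg.comp (measurable_pi_iff.2 fun i => measurable_pi_iff.2 fun j => ?_)
    induction i using Fin.cases <;> induction j using Fin.cases <;>
      simp [borderedMatrix] <;> fun_prop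
  simp_rw [lintegral_symmVol (hb _ _)]
  rw [lintegral_symmVol hg]
  have hg' := hg.comp (measurable_symmParam (m + 1))
  set e := (Equiv.ofBijective _ (symmIdxSuccMap_bijective m)) with he
  have h1 := (volume_measurePreserving_piCongrLeft
    (fun _ : SymmIdx (m + 1) => ℝ) e).lintegral_comp_emb
    (MeasurableEquiv.measurableEmbedding _) (g ∘ symmParam (m + 1))
  have h2 := (volume_measurePreserving_sumPiEquivProdPi_symm
    (fun _ : Unit ⊕ (Fin m ⊕ SymmIdx m) => ℝ))
  have h3 := (volume_measurePreserving_sumPiEquivProdPi_symm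
    (fun _ : (Fin m ⊕ SymmIdx m) => ℝ))
  have h4 := (volume_preserving_piUnique (fun _ : Unit => ℝ)).symm
  refine h1.symm.trans ?_
  rw [← h2.lintegral_comp_emb (MeasurableEquiv.measurableEmbedding _)]
  rw [Measure.volume_eq_prod, lintegral_prod]
  swap
  · refine Measurable.aemeasurable ?_
    exact (hg'.comp (MeasurableEquiv.measurable _)).comp (MeasurableEquiv.measurable _)
  rw [← h4.lintegral_comp_emb (MeasurableEquiv.measurableEmbedding _)]
  refine lintegral_congr fun a => ?_
  rw [← h3.lintegral_comp_emb (MeasurableEquiv.measurableEmbedding _)]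
  rw [Measure.volume_eq_prod, lintegral_prod]
  swap
  · refine Measurable.aemeasurable ?_
    refine ((hg'.comp (MeasurableEquiv.measurable _)).comp (MeasurableEquiv.measurable _)).comp ?_
    exact measurable_const.prodMk (MeasurableEquiv.measurable _)
  refine lintegral_congr fun b => lintegral_congr fun f => ?_
  simp only [Function.comp]
  congr 1
  have key : ∀ (q : Unit ⊕ (Fin m ⊕ SymmIdx m) → ℝ) (s),
      (MeasurableEquiv.piCongrLeft (fun _ : SymmIdx (m + 1) => ℝ) e) q (symmIdxSuccMap m s) = q s := by
    intro q s
    exact Equiv.piCongrLeft_apply_apply (fun _ : SymmIdx (m + 1) => ℝ) e q s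
  ext i j
  induction i using Fin.cases with
  | zero =>
    induction j using Fin.cases with
    | zero =>
      simp only [symmParam, borderedMatrix, Matrix.of_apply, Fin.cons_zero, le_refl, dite_true]
      exact key _ (Sum.inl ())
    | succ j =>
      simp [symmParam, borderedMatrix]
      exact key _ (Sum.inr (Sum.inl j))
  | succ i =>
    induction j using Fin.cases with
    | zero =>
      simp [symmParam, borderedMatrix]
      exact key _ (Sum.inr (Sum.inl i))
    | succ j =>
      by_cases hij : i ≤ j
      · simp [symmParam, borderedMatrix, hij]
        exact key _ (Sum.inr (Sum.inr ⟨(i, j), hij⟩))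
      · simp [symmParam, borderedMatrix, hij]
        exact key _ (Sum.inr (Sum.inr ⟨(j, i), le_of_not_ge hij⟩))

lemma lintegral_symmVol_add_right {m : ℕ} {g : Matrix (Fin m) (Fin m) ℝ → ENNReal}
    (hg : Measurable g) {M : Matrix (Fin m) (Fin m) ℝ} (hM : M.IsSymm) :
    ∫⁻ F, g (F + M) ∂symmVol m = ∫⁻ F, g F ∂symmVol m := by
  have hadd : Measurable fun F : Matrix (Fin m) (Fin m) ℝ => F + M :=
    (continuous_id.add continuous_const).measurable
  rw [lintegral_symmVol hg, lintegral_symmVol (g := fun F => g (F + M)) (hg.comp hadd),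
    ← lintegral_add_right_eq_self (fun f => g (symmParam m f)) (fun p : SymmIdx m => M p.1.1 p.1.2)]
  refine lintegral_congr fun f => ?_
  congr 1
  ext i j
  by_cases h : i ≤ j
  · simp [symmParam, h]
  · simp [symmParam, h, hM.apply i j]

lemma volume_dotProduct_self_le (n : ℕ) (r : ℝ) :
    volume {x : Fin (n + 1) → ℝ | x ⬝ᵥ x ≤ r} =
      ENNReal.ofReal (max r 0 ^ (((n + 1 : ℕ) : ℝ) / 2) *
        (π ^ (((n + 1 : ℕ) : ℝ) / 2) / Gamma (((n + 1 : ℕ) : ℝ) / 2 + 1))) := by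
  have hs : (0 : ℝ) < ((n + 1 : ℕ) : ℝ) / 2 := by positivity
  rcases lt_or_ge r 0 with hr | hr
  · have : {x : Fin (n + 1) → ℝ | x ⬝ᵥ x ≤ r} = ∅ := by
      ext x
      simpa using hr.trans_le (by simpa using dotProduct_star_self_nonneg x)
    rw [this, max_eq_right hr.le, zero_rpow hs.ne']
    simp
  · have hball := EuclideanSpace.volume_closedBall (Fin (n + 1)) 0 (√r)
    rw [← (PiLp.volume_preserving_toLp (Fin (n + 1))).measure_preimage
      measurableSet_closedBall.nullMeasurableSet] at hball
    have hset : {x : Fin (n + 1) → ℝ | x ⬝ᵥ x ≤ r} =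
        WithLp.toLp 2 ⁻¹' Metric.closedBall (0 : EuclideanSpace ℝ (Fin (n + 1))) √r := by
      ext x
      simp only [Set.mem_ofPred_eq, Set.mem_preimage, mem_closedBall_zero_iff,
        EuclideanSpace.norm_eq, Real.norm_eq_abs, sq_abs]
      rw [Real.sqrt_le_sqrt_iff hr]
      simp [dotProduct, sq]
    have hpow : ∀ y : ℝ, 0 ≤ y → √y ^ (n + 1) = y ^ (((n + 1 : ℕ) : ℝ) / 2) := by
      intro y hy
      rw [Real.sqrt_eq_rpow, ← Real.rpow_natCast, ← Real.rpow_mul hy]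
      congr 1
      ring
    rw [hset]
    refine hball.trans ?_
    rw [max_eq_left hr, Fintype.card_fin, ← ENNReal.ofReal_pow (Real.sqrt_nonneg _),
      ← ENNReal.ofReal_mul (by positivity), hpow _ hr, hpow _ Real.pi_pos.le]

/-- The law of `x ⬝ᵥ x` under Lebesgue measure, as a density. -/
noncomputable def sqNormDensity (n : ℕ) (a : ℝ) : ENNReal :=
  if 0 < a then ENNReal.ofReal (π ^ (((n + 1 : ℕ) : ℝ) / 2) / Gamma (((n + 1 : ℕ) : ℝ) / 2) *
    a ^ (((n + 1 : ℕ) : ℝ) / 2 - 1)) else 0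

lemma measurable_sqNormDensity (n : ℕ) : Measurable (sqNormDensity n) :=
  Measurable.ite measurableSet_Ioi (by fun_prop) measurable_const

lemma withDensity_sqNormDensity_Iic (n : ℕ) (r : ℝ) :
    (volume.withDensity (sqNormDensity n)) (Set.Iic r) =
      ENNReal.ofReal (max r 0 ^ (((n + 1 : ℕ) : ℝ) / 2) *
        (π ^ (((n + 1 : ℕ) : ℝ) / 2) / Gamma (((n + 1 : ℕ) : ℝ) / 2 + 1))) := by
  have hs : (0 : ℝ) < ((n + 1 : ℕ) : ℝ) / 2 := by positivity
  set s : ℝ := ((n + 1 : ℕ) : ℝ) / 2 with hsdef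
  have hG := Real.Gamma_pos_of_pos hs
  rw [withDensity_apply _ measurableSet_Iic]
  have hind : sqNormDensity n = (Set.Ioi (0 : ℝ)).indicator
      fun a => ENNReal.ofReal (π ^ s / Gamma s * a ^ (s - 1)) := by
    ext a
    simp [sqNormDensity, Set.indicator_apply, hsdef]
  rw [hind, lintegral_indicator measurableSet_Ioi, Measure.restrict_restrict measurableSet_Ioi,
    Set.Ioi_inter_Iic]
  rcases le_or_gt r 0 with hr | hr
  · rw [Set.Ioc_eq_empty (not_lt.2 hr), max_eq_right hr, zero_rpow hs.ne']
    simp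
  · have hInt : IntervalIntegrable (fun a : ℝ => π ^ s / Gamma s * a ^ (s - 1)) volume 0 r :=
      (intervalIntegral.intervalIntegrable_rpow' (by linarith)).const_mul _
    rw [← ofReal_integral_eq_lintegral_ofReal hInt.1, ← intervalIntegral.integral_of_le hr.le,
      intervalIntegral.integral_const_mul, integral_rpow (Or.inl (by linarith)),
      max_eq_left hr.le, Real.Gamma_add_one hs.ne']
    · congr 1
      rw [sub_add_cancel, zero_rpow hs.ne']
      field_simp
      ring
    · filter_upwards [ae_restrict_mem measurableSet_Ioc] with a ha
      have := ha.1
      positivity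

lemma map_dotProduct_self (n : ℕ) :
    Measure.map (fun x : Fin (n + 1) → ℝ => x ⬝ᵥ x) volume =
      volume.withDensity (sqNormDensity n) := by
  have hmeas : Measurable fun x : Fin (n + 1) → ℝ => x ⬝ᵥ x := by
    unfold dotProduct
    fun_prop
  have key : ∀ r, Measure.map (fun x : Fin (n + 1) → ℝ => x ⬝ᵥ x) volume (Set.Iic r) =
      (volume.withDensity (sqNormDensity n)) (Set.Iic r) := by
    intro r
    rw [Measure.map_apply hmeas measurableSet_Iic, withDensity_sqNormDensity_Iic]
    exact volume_dotProduct_self_le n r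
  have hfin : ∀ r, (volume.withDensity (sqNormDensity n)) (Set.Iic r) ≠ ⊤ := by
    intro r
    rw [withDensity_sqNormDensity_Iic]
    exact ENNReal.ofReal_ne_top
  refine Measure.ext_of_Ioc' _ _ (fun a b _ => ?_) fun a b hab => ?_
  · refine ne_top_of_le_ne_top (hfin b) ?_
    rw [← key]
    exact measure_mono Set.Ioc_subset_Iic_self
  · rw [← Set.Iic_sdiff_Iic,
      measure_sdiff (Set.Iic_subset_Iic.2 hab.le) nullMeasurableSet_Iic (by rw [key]; exact hfin a),
      measure_sdiff (Set.Iic_subset_Iic.2 hab.le) nullMeasurableSet_Iic (hfin a), key, key]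

lemma lintegral_dotProduct_self (n : ℕ) {φ : ℝ → ENNReal} (hφ : Measurable φ) :
    ∫⁻ x : Fin (n + 1) → ℝ, φ (x ⬝ᵥ x) = ∫⁻ a, sqNormDensity n a * φ a := by
  have hmeas : Measurable fun x : Fin (n + 1) → ℝ => x ⬝ᵥ x := by
    unfold dotProduct
    fun_prop
  rw [← lintegral_map hφ hmeas, map_dotProduct_self,
    lintegral_withDensity_eq_lintegral_mul _ (measurable_sqNormDensity n) hφ]
  rfl

lemma measurePreserving_mul_left_of_involutive {n m : ℕ} {H : Matrix (Fin n) (Fin n) ℝ}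
    (hH : H * H = 1) :
    MeasurePreserving (fun Y : Matrix (Fin n) (Fin m) ℝ => H * Y) volume volume := by
  let L : (Fin n → Fin m → ℝ) →ₗ[ℝ] (Fin n → Fin m → ℝ) :=
    { toFun := fun Y => H * (Matrix.of Y)
      map_add' := fun Y Z => Matrix.mul_add H (Matrix.of Y) (Matrix.of Z)
      map_smul' := fun c Y => Matrix.mul_smul H c (Matrix.of Y) }
  have hL : L * L = 1 := by
    refine LinearMap.ext fun Y => ?_
    change H * (H * Matrix.of Y) = Matrix.of Y
    rw [← Matrix.mul_assoc, hH, Matrix.one_mul]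
  have hdet : LinearMap.det L * LinearMap.det L = 1 := by
    rw [← map_mul, hL, map_one]
  have habs : |LinearMap.det L| = 1 := by
    rcases mul_self_eq_one_iff.1 hdet with h | h <;> simp [h]
  have hne : LinearMap.det L ≠ 0 := fun h => by simp [h] at hdet
  refine ⟨L.continuous_of_finiteDimensional.measurable, ?_⟩
  have := Measure.map_linearMap_addHaar_eq_smul_addHaar
    (volume : Measure (Fin n → Fin m → ℝ)) hne
  rw [abs_inv, habs, inv_one, ENNReal.ofReal_one, one_smul] at this
  exact this

lemma exists_reflection {n : ℕ} (x : Fin (n + 1) → ℝ) :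
    ∃ H : Matrix (Fin (n + 1)) (Fin (n + 1)) ℝ, H * H = 1 ∧ Hᵀ = H ∧
      H *ᵥ x = Pi.single 0 √(x ⬝ᵥ x) := by
  have hxx : 0 ≤ x ⬝ᵥ x := by simpa using dotProduct_star_self_nonneg x
  set w : Fin (n + 1) → ℝ := Pi.single 0 √(x ⬝ᵥ x) with hw
  set v := x - w with hv
  have hww : w ⬝ᵥ w = x ⬝ᵥ x := by simp [hw, Real.mul_self_sqrt hxx]
  by_cases h : v ⬝ᵥ v = 0
  · refine ⟨1, by simp, by simp, ?_⟩
    rw [one_mulVec]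
    exact sub_eq_zero.1 (dotProduct_self_eq_zero.1 h)
  · have hsq : vecMulVec v v * vecMulVec v v = (v ⬝ᵥ v) • vecMulVec v v := by
      rw [vecMulVec_mul_vecMulVec, vecMulVec_smul]
    have hvx : v ⬝ᵥ v = 2 * (v ⬝ᵥ x) := by
      simp only [hv, sub_dotProduct, dotProduct_sub, hww, dotProduct_comm x w]
      ring
    refine ⟨1 - (2 / (v ⬝ᵥ v)) • vecMulVec v v, ?_, ?_, ?_⟩
    · simp only [sub_mul, mul_sub, one_mul, mul_one, smul_mul_assoc, mul_smul_comm, hsq, smul_smul]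
      rw [div_mul_cancel₀ _ h]
      module
    · simp [transpose_vecMulVec]
    · rw [sub_mulVec, one_mulVec, smul_mulVec, vecMulVec_mulVec]
      ext i
      have hne : v ⬝ᵥ x ≠ 0 := fun h0 => h (by rw [hvx, h0, mul_zero])
      simp [hvx]
      field_simp
      simp [hv]

lemma lintegral_matrix_column {n m : ℕ} {h : Matrix (Fin n) (Fin (m + 1)) ℝ → ENNReal}
    (hh : Measurable h) :
    ∫⁻ X, h X = ∫⁻ x : Fin n → ℝ, ∫⁻ Y : Matrix (Fin n) (Fin m) ℝ,
      h (Matrix.of fun i => Fin.cons (x i) (Y i)) := by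
  have h1 := (volume_preserving_pi (fun _ : Fin n =>
    volume_preserving_piFinSuccAbove (fun _ : Fin (m + 1) => ℝ) 0))
  have h1' : MeasurePreserving (MeasurableEquiv.piCongrRight (fun _ : Fin n =>
    MeasurableEquiv.piFinSuccAbove (fun _ : Fin (m + 1) => ℝ) 0)) volume volume := h1
  have h2 := volume_measurePreserving_arrowProdEquivProdArrow ℝ (Fin m → ℝ) (Fin n)
  have h3 := (h2.symm.trans h1'.symm)
  have h4 := h3.lintegral_comp_emb (MeasurableEquiv.measurableEmbedding _) h
  refine h4.symm.trans ?_
  rw [Measure.volume_eq_prod, lintegral_prod]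
  swap
  · exact (hh.comp (MeasurableEquiv.measurable _)).aemeasurable
  refine lintegral_congr fun x => lintegral_congr fun Y => ?_
  congr 1
  ext i j
  induction j using Fin.cases <;> rfl

lemma lintegral_matrix_row {n m : ℕ} {h : Matrix (Fin (n + 1)) (Fin m) ℝ → ENNReal}
    (hh : Measurable h) :
    ∫⁻ X, h X = ∫⁻ z : Fin m → ℝ, ∫⁻ Z : Matrix (Fin n) (Fin m) ℝ,
      h (Matrix.of (Fin.cons z Z)) := by
  have h1 := volume_preserving_piFinSuccAbove (fun _ : Fin (n + 1) => Fin m → ℝ) 0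
  have h4 := h1.symm.lintegral_comp_emb (MeasurableEquiv.measurableEmbedding _) h
  refine h4.symm.trans ?_
  rw [Measure.volume_eq_prod, lintegral_prod]
  swap
  · exact (hh.comp (MeasurableEquiv.measurable _)).aemeasurable
  refine lintegral_congr fun x => lintegral_congr fun Y => ?_
  congr 1
  ext i j
  induction i using Fin.cases <;> rfl

instance (n m : ℕ) : SecondCountableTopology (Matrix (Fin n) (Fin m) ℝ) :=
  inferInstanceAs (SecondCountableTopology (Fin n → Fin m → ℝ))

instance (n m : ℕ) : SFinite (volume : Measure (Matrix (Fin n) (Fin m) ℝ)) :=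
  inferInstanceAs (SFinite (volume : Measure (Fin n → Fin m → ℝ)))

lemma continuous_borderedMatrix (m : ℕ) :
    Continuous fun p : ℝ × (Fin m → ℝ) × Matrix (Fin m) (Fin m) ℝ =>
      borderedMatrix p.1 p.2.1 p.2.2 := by
  refine continuous_matrix fun i j => ?_
  induction i using Fin.cases with
  | zero => induction j using Fin.cases <;> simp [borderedMatrix] <;> fun_prop
  | succ i =>
    induction j using Fin.cases with
    | zero => simp [borderedMatrix]; fun_prop
    | succ j =>
      simp [borderedMatrix]
      exact (continuous_snd.comp continuous_snd).matrix_elem i j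

lemma measurableSet_posDef (m : ℕ) : MeasurableSet {F : Matrix (Fin m) (Fin m) ℝ | F.PosDef} := by
  have h : {F : Matrix (Fin m) (Fin m) ℝ | F.PosDef} =
      ({F | F.IsHermitian} ∩ ⋂ x : Fin m → ℝ, {F | 0 ≤ star x ⬝ᵥ (F *ᵥ x)}) ∩ {F | F.det ≠ 0} := by
    ext F
    simp only [Set.mem_inter_iff, Set.mem_iInter, Set.mem_ofPred_eq,
      ← posSemidef_iff_dotProduct_mulVec]
    exact ⟨fun hF => ⟨hF.posSemidef, hF.det_pos.ne'⟩,
      fun hF => hF.1.posDef_iff_det_ne_zero.2 hF.2⟩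
  rw [h]
  refine (IsClosed.measurableSet (IsClosed.inter ?_ ?_)).inter (IsOpen.measurableSet ?_)
  · exact isClosed_eq (by fun_prop) continuous_id
  · exact isClosed_iInter fun x => isClosed_le continuous_const (by fun_prop)
  · exact isOpen_ne_fun (by fun_prop) continuous_const

/-- The blocks of a matrix bordered along its first row and column. -/
noncomputable def unitSumFinEquiv (m : ℕ) : Unit ⊕ Fin m ≃ Fin (m + 1) where
  toFun := Sum.elim (fun _ => 0) Fin.succ
  invFun := Fin.cases (Sum.inl ()) Sum.inr
  left_inv := by rintro (_ | _) <;> rfl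
  right_inv := by intro i; induction i using Fin.cases <;> rfl

lemma borderedMatrix_submatrix {m : ℕ} (a : ℝ) (b : Fin m → ℝ) (G : Matrix (Fin m) (Fin m) ℝ) :
    (borderedMatrix a b G).submatrix (unitSumFinEquiv m) (unitSumFinEquiv m) =
      fromBlocks (diagonal fun _ : Unit => a) (replicateRow Unit b) (replicateRow Unit b)ᴴ G := by
  ext (i | i) (j | j) <;> simp [borderedMatrix, unitSumFinEquiv, replicateRow]

lemma det_borderedMatrix {m : ℕ} {a : ℝ} (ha : a ≠ 0) (b : Fin m → ℝ)
    (G : Matrix (Fin m) (Fin m) ℝ) :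
    (borderedMatrix a b G).det = a * (G - a⁻¹ • vecMulVec b b).det := by
  have hu : IsUnit (diagonal fun _ : Unit => a) := by
    rw [isUnit_iff_isUnit_det]; simpa using ha
  let := hu.invertible
  rw [← det_submatrix_equiv_self (unitSumFinEquiv m), borderedMatrix_submatrix,
    det_fromBlocks₁₁, invOf_eq_nonsing_inv]
  congr 2
  · simp
  · ext i j
    simp [mul_apply, diagonal, replicateRow, vecMulVec_apply, Ring.inverse_eq_inv']
    ring

lemma posDef_borderedMatrix_iff {m : ℕ} {a : ℝ} {b : Fin m → ℝ} {G : Matrix (Fin m) (Fin m) ℝ} :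
    (borderedMatrix a b G).PosDef ↔ 0 < a ∧ (G - a⁻¹ • vecMulVec b b).PosDef := by
  by_cases ha : 0 < a
  swap
  · refine iff_of_false (fun h => ha ?_) fun h => ha h.1
    simpa [borderedMatrix] using h.diag_pos (i := 0)
  have hA : (diagonal fun _ : Unit => a).PosDef := posDef_diagonal_iff.2 fun _ => ha
  let := hA.isUnit.invertible
  have hpsd : (borderedMatrix a b G).PosSemidef ↔ (G - a⁻¹ • vecMulVec b b).PosSemidef := by
    rw [← posSemidef_submatrix_equiv (unitSumFinEquiv m), borderedMatrix_submatrix,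
      PosDef.fromBlocks₁₁ _ _ hA]
    refine iff_of_eq (congrArg _ ?_)
    ext i j
    simp [mul_apply, diagonal, replicateRow, vecMulVec_apply, Ring.inverse_eq_inv']
    ring
  have hdet := det_borderedMatrix ha.ne' b G
  constructor
  · intro h
    refine ⟨ha, (hpsd.1 h.posSemidef).posDef_iff_det_ne_zero.2 fun h0 => ?_⟩
    exact h.det_pos.ne' (by rw [hdet, h0, mul_zero])
  · rintro ⟨-, h⟩
    refine (hpsd.2 h.posSemidef).posDef_iff_det_ne_zero.2 ?_
    rw [hdet]
    exact mul_ne_zero ha.ne' h.det_pos.ne'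

/-- The density of the Gram matrix `XᵀX` under Lebesgue measure on `n × m` matrices `X`. -/
noncomputable def gramDensity (n m : ℕ) (F : Matrix (Fin m) (Fin m) ℝ) : ENNReal :=
  if F.PosDef then
    ENNReal.ofReal (π ^ (((m * n : ℕ) : ℝ) / 2) / mvGamma m ((n : ℝ) / 2) *
      F.det ^ (((n : ℝ) - (m : ℝ) - 1) / 2))
  else 0

lemma measurable_gramDensity (n m : ℕ) : Measurable (gramDensity n m) := by
  refine Measurable.ite (measurableSet_posDef m) ?_ measurable_const
  have : Measurable fun F : Matrix (Fin m) (Fin m) ℝ => F.det :=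
    (continuous_id.matrix_det).measurable
  fun_prop

lemma mvGamma_succ (n m : ℕ) :
    mvGamma (m + 1) (((n + 1 : ℕ) : ℝ) / 2) =
      Gamma (((n + 1 : ℕ) : ℝ) / 2) * (π ^ ((m : ℝ) / 2) * mvGamma m ((n : ℝ) / 2)) := by
  have hπ : π ^ ((((m + 1) * (m + 1 - 1) : ℕ) : ℝ) / 4) =
      π ^ ((m : ℝ) / 2) * π ^ (((m * (m - 1) : ℕ) : ℝ) / 4) := by
    rw [← Real.rpow_add Real.pi_pos]
    congr 1
    rcases m with _ | m
    · simp
    · push_cast [Nat.add_sub_cancel]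
      ring
  rw [mvGamma, mvGamma, Fin.prod_univ_succ, hπ]
  have : ∀ i : Fin m, Gamma (((n + 1 : ℕ) : ℝ) / 2 - ((i.succ : Fin (m + 1)) : ℝ) / 2) =
      Gamma ((n : ℝ) / 2 - (i : ℝ) / 2) := by
    intro i
    congr 1
    push_cast [Fin.val_succ]
    ring
  simp only [this, Fin.val_zero, Nat.cast_zero, zero_div, sub_zero]
  ring

lemma gramDensity_borderedMatrix {n m : ℕ} (a : ℝ) (b : Fin m → ℝ)
    (G : Matrix (Fin m) (Fin m) ℝ) :
    gramDensity (n + 1) (m + 1) (borderedMatrix a b G) =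
      sqNormDensity n a * (ENNReal.ofReal (a ^ (-((m : ℝ) / 2))) *
        gramDensity n m (G - a⁻¹ • vecMulVec b b)) := by
  by_cases ha : 0 < a
  swap
  · simp [gramDensity, sqNormDensity, posDef_borderedMatrix_iff, ha]
  by_cases hG : (G - a⁻¹ • vecMulVec b b).PosDef
  swap
  · simp [gramDensity, posDef_borderedMatrix_iff, hG]
  have hd := hG.det_pos
  have hΓ : 0 < Gamma (((n + 1 : ℕ) : ℝ) / 2) := Real.Gamma_pos_of_pos (by positivity)
  rw [gramDensity, if_pos (posDef_borderedMatrix_iff.2 ⟨ha, hG⟩), gramDensity, if_pos hG,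
    sqNormDensity, if_pos ha, ← ENNReal.ofReal_mul (by positivity),
    ← ENNReal.ofReal_mul (by positivity), det_borderedMatrix ha.ne', mvGamma_succ,
    Real.mul_rpow ha.le hd.le]
  congr 1
  have h1 : (((n + 1 : ℕ) : ℝ) - ((m + 1 : ℕ) : ℝ) - 1) / 2 = ((n : ℝ) - m - 1) / 2 := by
    push_cast; ring
  have h2 : a ^ (((n : ℝ) - m - 1) / 2) =
      a ^ (((n + 1 : ℕ) : ℝ) / 2 - 1) * a ^ (-((m : ℝ) / 2)) := by
    rw [← Real.rpow_add ha]; congr 1; push_cast; ring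
  have h3 : π ^ ((((m + 1) * (n + 1) : ℕ) : ℝ) / 2) =
      π ^ (((n + 1 : ℕ) : ℝ) / 2) * (π ^ ((m : ℝ) / 2) * π ^ (((m * n : ℕ) : ℝ) / 2)) := by
    rw [← Real.rpow_add Real.pi_pos, ← Real.rpow_add Real.pi_pos]; congr 1; push_cast; ring
  have h4 : (0 : ℝ) < π ^ ((m : ℝ) / 2) := by positivity
  rw [h1, h2, h3, mul_div_mul_comm, mul_div_mul_left _ _ h4.ne']
  ring

lemma gram_column {n m : ℕ} (x : Fin n → ℝ) (Y : Matrix (Fin n) (Fin m) ℝ) :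
    (Matrix.of fun i => (Fin.cons (x i) (Y i) : Fin (m + 1) → ℝ))ᵀ *
      (Matrix.of fun i => (Fin.cons (x i) (Y i) : Fin (m + 1) → ℝ)) =
      borderedMatrix (x ⬝ᵥ x) (Yᵀ *ᵥ x) (Yᵀ * Y) := by
  ext i j
  induction i using Fin.cases <;> induction j using Fin.cases <;>
    simp [borderedMatrix, mul_apply, dotProduct, mulVec, mul_comm]

lemma gram_row {n m : ℕ} (z : Fin m → ℝ) (Z : Matrix (Fin n) (Fin m) ℝ) :
    (Matrix.of (Fin.cons z Z : Fin (n + 1) → Fin m → ℝ))ᵀ *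
      (Matrix.of (Fin.cons z Z : Fin (n + 1) → Fin m → ℝ)) = Zᵀ * Z + vecMulVec z z := by
  ext i j
  rw [mul_apply, Fin.sum_univ_succ, Matrix.add_apply, mul_apply, vecMulVec_apply, add_comm]
  rfl

lemma lintegral_smul_sqrt {m : ℕ} {a : ℝ} (ha : 0 < a) {k : (Fin m → ℝ) → ENNReal}
    (hk : Measurable k) :
    ∫⁻ z : Fin m → ℝ, k (√a • z) = ENNReal.ofReal (a ^ (-((m : ℝ) / 2))) * ∫⁻ b, k b := by
  have hs : √a ≠ 0 := (Real.sqrt_pos.2 ha).ne'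
  have h := Measure.map_addHaar_smul (volume : Measure (Fin m → ℝ)) hs
  rw [← lintegral_map hk (by fun_prop), h, lintegral_smul_measure, smul_eq_mul]
  congr 2
  rw [Module.finrank_fin_fun, abs_of_pos (by positivity), Real.rpow_neg ha.le, Real.sqrt_eq_rpow,
    ← Real.rpow_natCast, ← Real.rpow_mul ha.le]
  congr 2
  ring

lemma lintegral_gram_of_column {n m : ℕ} {g : Matrix (Fin (m + 1)) (Fin (m + 1)) ℝ → ENNReal}
    (hg : Measurable g) (x : Fin (n + 1) → ℝ) :
    ∫⁻ Y : Matrix (Fin (n + 1)) (Fin m) ℝ, g (borderedMatrix (x ⬝ᵥ x) (Yᵀ *ᵥ x) (Yᵀ * Y)) =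
      ∫⁻ z : Fin m → ℝ, ∫⁻ Z : Matrix (Fin n) (Fin m) ℝ,
        g (borderedMatrix (x ⬝ᵥ x) (√(x ⬝ᵥ x) • z) (Zᵀ * Z + vecMulVec z z)) := by
  obtain ⟨H, hHH, hHt, hHx⟩ := exists_reflection x
  have hmeas : Measurable fun Y : Matrix (Fin (n + 1)) (Fin m) ℝ =>
      g (borderedMatrix (x ⬝ᵥ x) (Yᵀ *ᵥ x) (Yᵀ * Y)) :=
    hg.comp ((continuous_borderedMatrix m).comp
      (f := fun Y : Matrix (Fin (n + 1)) (Fin m) ℝ => (x ⬝ᵥ x, Yᵀ *ᵥ x, Yᵀ * Y))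
      (by fun_prop)).measurable
  have hmeas' : Measurable fun Y : Matrix (Fin (n + 1)) (Fin m) ℝ =>
      g (borderedMatrix (x ⬝ᵥ x) (Yᵀ *ᵥ Pi.single 0 √(x ⬝ᵥ x)) (Yᵀ * Y)) :=
    hg.comp ((continuous_borderedMatrix m).comp
      (f := fun Y : Matrix (Fin (n + 1)) (Fin m) ℝ =>
        (x ⬝ᵥ x, Yᵀ *ᵥ Pi.single 0 √(x ⬝ᵥ x), Yᵀ * Y))
      (by fun_prop)).measurable
  have hrot : ∀ Y : Matrix (Fin (n + 1)) (Fin m) ℝ,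
      g (borderedMatrix (x ⬝ᵥ x) ((H * Y)ᵀ *ᵥ x) ((H * Y)ᵀ * (H * Y))) =
        g (borderedMatrix (x ⬝ᵥ x) (Yᵀ *ᵥ Pi.single 0 √(x ⬝ᵥ x)) (Yᵀ * Y)) := by
    intro Y
    rw [transpose_mul, hHt, ← mulVec_mulVec, hHx, Matrix.mul_assoc, ← Matrix.mul_assoc H H, hHH,
      Matrix.one_mul]
  rw [← (measurePreserving_mul_left_of_involutive hHH).lintegral_comp hmeas]
  simp_rw [hrot]
  rw [lintegral_matrix_row hmeas']
  refine lintegral_congr fun z => lintegral_congr fun Z => ?_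
  rw [gram_row]
  congr 2
  ext j
  simp only [mulVec_single, Pi.smul_apply]
  exact mul_comm _ _

lemma lintegral_gram {m n : ℕ} (hmn : m ≤ n) {g : Matrix (Fin m) (Fin m) ℝ → ENNReal}
    (hg : Measurable g) :
    ∫⁻ X : Matrix (Fin n) (Fin m) ℝ, g (Xᵀ * X) = ∫⁻ F, gramDensity n m F * g F ∂symmVol m := by
  induction m generalizing n with
  | zero =>
    rw [lintegral_symmVol (g := fun F => gramDensity n 0 F * g F)
      ((measurable_gramDensity n 0).mul hg)]
    have h1 : ∀ F : Matrix (Fin 0) (Fin 0) ℝ, gramDensity n 0 F = 1 := by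
      intro F
      have : F.PosDef := by
        rw [Subsingleton.elim F 1]; exact PosDef.one
      simp [gramDensity, this, mvGamma]
    have h2 : ∀ F : Matrix (Fin 0) (Fin 0) ℝ, g F = g 0 := fun F => by
      rw [Subsingleton.elim F 0]
    simp_rw [h1, h2, one_mul, lintegral_const]
    congr 1
    have h3 : (volume : Measure (Matrix (Fin n) (Fin 0) ℝ)) Set.univ = 1 := by
      change (Measure.pi fun _ : Fin n => (volume : Measure (Fin 0 → ℝ))) Set.univ = 1
      have h0 : (volume : Measure (Fin 0 → ℝ)) Set.univ = 1 := by simp [volume_pi]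
      simp [Measure.pi_univ, h0]
    rw [h3]
    have : IsEmpty (SymmIdx 0) := ⟨fun p => p.1.1.elim0⟩
    simp [volume_pi]
  | succ m ih =>
    obtain ⟨n, rfl⟩ : ∃ n', n = n' + 1 := ⟨n - 1, by omega⟩
    have hφ : Measurable fun a : ℝ => ∫⁻ z : Fin m → ℝ, ∫⁻ Z : Matrix (Fin n) (Fin m) ℝ,
        g (borderedMatrix a (√a • z) (Zᵀ * Z + vecMulVec z z)) := by
      refine Measurable.lintegral_prod_right (Measurable.lintegral_prod_right
        (f := fun (p : ℝ × (Fin m → ℝ)) (Z : Matrix (Fin n) (Fin m) ℝ) =>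
          g (borderedMatrix p.1 (√p.1 • p.2) (Zᵀ * Z + vecMulVec p.2 p.2))) ?_)
      exact hg.comp ((continuous_borderedMatrix m).comp
        (f := fun q : (ℝ × (Fin m → ℝ)) × Matrix (Fin n) (Fin m) ℝ =>
          (q.1.1, √q.1.1 • q.1.2, q.2ᵀ * q.2 + vecMulVec q.1.2 q.1.2))
        (by fun_prop)).measurable
    have hgram : Measurable fun X : Matrix (Fin (n + 1)) (Fin (m + 1)) ℝ => g (Xᵀ * X) :=
      hg.comp (Continuous.measurable (by fun_prop))
    rw [lintegral_matrix_column hgram]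
    simp_rw [gram_column, lintegral_gram_of_column hg]
    rw [lintegral_dotProduct_self n hφ,
      lintegral_symmVol_succ (g := fun F => gramDensity (n + 1) (m + 1) F * g F)
        ((measurable_gramDensity (n + 1) (m + 1)).mul hg)]
    refine lintegral_congr fun a => ?_
    by_cases ha : 0 < a
    swap
    · simp [gramDensity, sqNormDensity, posDef_borderedMatrix_iff, ha]
    set k : (Fin m → ℝ) → ENNReal := fun b => ∫⁻ G,
      gramDensity n m (G - a⁻¹ • vecMulVec b b) * g (borderedMatrix a b G) ∂symmVol m with hk
    have hjoint : Measurable fun p : (Fin m → ℝ) × Matrix (Fin m) (Fin m) ℝ =>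
        gramDensity n m (p.2 - a⁻¹ • vecMulVec p.1 p.1) * g (borderedMatrix a p.1 p.2) := by
      refine ((measurable_gramDensity n m).comp (Continuous.measurable (by fun_prop))).mul
        (hg.comp ((continuous_borderedMatrix m).comp
          (f := fun p : (Fin m → ℝ) × Matrix (Fin m) (Fin m) ℝ => (a, p.1, p.2))
          (by fun_prop)).measurable)
    have hkm : Measurable k := hjoint.lintegral_prod_right'
    have hinner : ∀ z : Fin m → ℝ, ∫⁻ Z : Matrix (Fin n) (Fin m) ℝ,
        g (borderedMatrix a (√a • z) (Zᵀ * Z + vecMulVec z z)) = k (√a • z) := by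
      intro z
      have hzz : a⁻¹ • vecMulVec (√a • z) (√a • z) = vecMulVec z z := by
        rw [smul_vecMulVec, vecMulVec_smul, smul_smul, smul_smul, mul_assoc,
          Real.mul_self_sqrt ha.le,
          inv_mul_cancel₀ ha.ne', one_smul]
      have hm1 : Measurable fun S : Matrix (Fin m) (Fin m) ℝ =>
          g (borderedMatrix a (√a • z) (S + vecMulVec z z)) :=
        hg.comp ((continuous_borderedMatrix m).comp
          (f := fun S : Matrix (Fin m) (Fin m) ℝ => (a, √a • z, S + vecMulVec z z))
          (by fun_prop)).measurable
      rw [ih (by omega) hm1]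
      have hsymm : (vecMulVec z z).IsSymm := transpose_vecMulVec z z
      simp only [hk]
      rw [← lintegral_symmVol_add_right
        (g := fun G => gramDensity n m (G - a⁻¹ • vecMulVec (√a • z) (√a • z)) *
          g (borderedMatrix a (√a • z) G))
        (hjoint.comp (by fun_prop : Measurable fun G : Matrix (Fin m) (Fin m) ℝ => (√a • z, G)))
        hsymm]
      simp only [hzz, add_sub_cancel_right]
    simp_rw [hinner]
    rw [lintegral_smul_sqrt ha hkm, ← lintegral_const_mul _ hkm,
      ← lintegral_const_mul _ (hkm.const_mul _)]
    refine lintegral_congr fun b => ?_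
    have hb : Measurable fun G : Matrix (Fin m) (Fin m) ℝ =>
        gramDensity n m (G - a⁻¹ • vecMulVec b b) * g (borderedMatrix a b G) :=
      hjoint.comp (by fun_prop : Measurable fun G : Matrix (Fin m) (Fin m) ℝ => (b, G))
    simp only [hk]
    rw [← lintegral_const_mul _ hb, ← lintegral_const_mul _ (hb.const_mul _)]
    refine lintegral_congr fun G => ?_
    rw [gramDensity_borderedMatrix]
    ring

lemma princMinor_transpose {m : ℕ} (A : Matrix (Fin m) (Fin m) ℝ) (i : Fin m) :
    princMinor Aᵀ i = princMinor A i := by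
  rw [princMinor, princMinor, ← transpose_submatrix, det_transpose]

lemma princMinor_mul_of_blockTriangular {m : ℕ} (A : Matrix (Fin m) (Fin m) ℝ)
    {U : Matrix (Fin m) (Fin m) ℝ} (hU : U.BlockTriangular id) (i : Fin m) :
    princMinor (A * U) i = princMinor A i * princMinor U i := by
  rw [princMinor, princMinor, princMinor, ← det_mul]
  congr 1
  ext r s
  rw [submatrix_apply, mul_apply, mul_apply]
  symm
  refine Finset.sum_of_injOn (Fin.castLE i.isLt) (Fin.castLE_injective _).injOn
    (by simp) (fun j _ hj => ?_) (fun _ _ => rfl)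
  rw [hU, mul_zero]
  by_contra hlt
  have hjs : j.1 ≤ s.1 := by simpa [Fin.lt_def] using hlt
  exact hj ⟨⟨j.1, by omega⟩, by simp, rfl⟩

lemma princMinor_transpose_mul_mul {m : ℕ} (A : Matrix (Fin m) (Fin m) ℝ)
    {U : Matrix (Fin m) (Fin m) ℝ} (hU : U.BlockTriangular id) (i : Fin m) :
    princMinor (Uᵀ * A * U) i = princMinor A i * princMinor (Uᵀ * U) i := by
  rw [princMinor_mul_of_blockTriangular _ hU, princMinor_mul_of_blockTriangular _ hU,
    princMinor_transpose, ← princMinor_transpose, transpose_mul, transpose_transpose,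
    princMinor_mul_of_blockTriangular _ hU, princMinor_transpose]
  ring

lemma princMinor_pos {m : ℕ} {A : Matrix (Fin m) (Fin m) ℝ} (hA : A.PosDef) (i : Fin m) :
    0 < princMinor A i :=
  (hA.submatrix (Fin.castLE_injective i.isLt)).det_pos

lemma hwv_pos {m : ℕ} (κ : Fin m → ℝ) {A : Matrix (Fin m) (Fin m) ℝ} (hA : A.PosDef) :
    0 < hwv κ A :=
  Finset.prod_pos fun i _ => Real.rpow_pos_of_pos (princMinor_pos hA i) _

lemma hwv_transpose_mul_mul {m : ℕ} (κ : Fin m → ℝ) {A U : Matrix (Fin m) (Fin m) ℝ}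
    (hA : A.PosDef) (hU : U.BlockTriangular id) (hUU : (Uᵀ * U).PosDef) :
    hwv κ (Uᵀ * A * U) = hwv κ A * hwv κ (Uᵀ * U) := by
  simp only [hwv, ← Finset.prod_mul_distrib]
  refine Finset.prod_congr rfl fun i _ => ?_
  rw [princMinor_transpose_mul_mul A hU,
    Real.mul_rpow (princMinor_pos hA i).le (princMinor_pos hUU i).le]

lemma measurable_hwv {m : ℕ} (κ : Fin m → ℝ) : Measurable (hwv κ) := by
  refine Finset.measurable_prod _ fun i _ => Measurable.pow_const ?_ _
  exact (Continuous.matrix_det (by fun_prop)).measurable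

lemma posDef_inv_transpose_mul_mul_inv {m : ℕ} {F U : Matrix (Fin m) (Fin m) ℝ}
    (hF : F.PosDef) (hU : IsUnit U) : ((Uᵀ)⁻¹ * F * U⁻¹).PosDef := by
  have h := hF.conjTranspose_mul_mul_same (B := U⁻¹)
    (mulVec_injective_of_isUnit ((isUnit_nonsing_inv_iff).2 hU))
  rwa [conjTranspose_eq_transpose_of_trivial, transpose_nonsing_inv] at h

lemma hwv_inv_transpose_mul_mul_inv {m : ℕ} (κ : Fin m → ℝ) {F U : Matrix (Fin m) (Fin m) ℝ}
    (hF : F.PosDef) (hU : U.BlockTriangular id) (hUU : (Uᵀ * U).PosDef) (hU' : IsUnit U) :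
    hwv κ ((Uᵀ)⁻¹ * F * U⁻¹) = hwv κ F / hwv κ (Uᵀ * U) := by
  rw [eq_div_iff (hwv_pos κ hUU).ne',
    ← hwv_transpose_mul_mul κ (posDef_inv_transpose_mul_mul_inv hF hU') hU hUU]
  have hd : IsUnit U.det := (isUnit_iff_isUnit_det U).1 hU'
  have hd' : IsUnit Uᵀ.det := by rwa [det_transpose]
  congr 1
  rw [Matrix.mul_assoc, Matrix.mul_assoc, nonsing_inv_mul _ hd, Matrix.mul_one,
    ← Matrix.mul_assoc, mul_nonsing_inv _ hd', Matrix.one_mul]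

lemma trace_inv_mul_nonneg {m : ℕ} {S F : Matrix (Fin m) (Fin m) ℝ} (hF : F.PosDef)
    {U : Matrix (Fin m) (Fin m) ℝ} (hS : S = Uᵀ * U) (hU : IsUnit U) :
    0 ≤ (S⁻¹ * F).trace := by
  have h := (posDef_inv_transpose_mul_mul_inv hF hU).posSemidef.trace_nonneg
  rwa [trace_mul_comm, ← Matrix.mul_assoc, ← Matrix.mul_inv_rev, ← hS] at h

/-- The type I matrix T-Riesz density at location `0` and row scale `1`, as a function of the
Gram matrix `F = XᵀX`. -/
noncomputable def tRieszIGramDen (n m : ℕ) (ν k ρ : ℝ) (τ : Fin m → ℝ)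
    (Sig U F : Matrix (Fin m) (Fin m) ℝ) : ℝ :=
  mvGamma m ((n : ℝ) / 2) * Real.Gamma ((ν + (m * n : ℕ)) / 2 + k + ∑ i, τ i) *
      ρ ^ (((m * n : ℕ) : ℝ) / 2 + ∑ i, τ i) /
      (Real.pi ^ (((m * n : ℕ) : ℝ) / 2) * mvGammaI m ((n : ℝ) / 2) τ *
        Real.Gamma (ν / 2 + k) * Sig.det ^ ((n : ℝ) / 2)) *
    (1 + ρ * (Sig⁻¹ * F).trace) ^ (-((ν + (m * n : ℕ)) / 2 + k + ∑ i, τ i)) *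
    hwv τ ((Uᵀ)⁻¹ * F * U⁻¹)

lemma tRieszIDen_zero_one (n m : ℕ) (ν k ρ : ℝ) (τ : Fin m → ℝ)
    (Sig U : Matrix (Fin m) (Fin m) ℝ) (X : Matrix (Fin n) (Fin m) ℝ) :
    tRieszIDen n m ν k ρ τ 0 1 Sig U X = tRieszIGramDen n m ν k ρ τ Sig U (Xᵀ * X) := by
  simp [tRieszIDen, tRieszIGramDen, Matrix.mul_assoc]

lemma measurable_tRieszIGramDen (n m : ℕ) (ν k ρ : ℝ) (τ : Fin m → ℝ)
    (Sig U : Matrix (Fin m) (Fin m) ℝ) : Measurable (tRieszIGramDen n m ν k ρ τ Sig U) := by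
  refine Measurable.mul (measurable_const.mul (Measurable.pow_const ?_ _))
    ((measurable_hwv τ).comp (Continuous.measurable (by fun_prop)))
  exact Continuous.measurable (by fun_prop)

lemma mvGamma_pos {n m : ℕ} (hmn : m ≤ n) : 0 < mvGamma m ((n : ℝ) / 2) := by
  refine mul_pos (by positivity) (Finset.prod_pos fun i _ => Real.Gamma_pos_of_pos ?_)
  have : (i : ℝ) < n := by exact_mod_cast i.isLt.trans_le hmn
  linarith

lemma mvGammaI_pos {m : ℕ} {a : ℝ} {τ : Fin m → ℝ} (hτ : ∀ i : Fin m, 0 < a + τ i - (i : ℝ) / 2) :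
    0 < mvGammaI m a τ :=
  mul_pos (by positivity) (Finset.prod_pos fun i _ => Real.Gamma_pos_of_pos (hτ i))

lemma half_mul_add_sum_nonneg {n m : ℕ} {τ : Fin m → ℝ}
    (hτ : ∀ i : Fin m, 0 < (n : ℝ) / 2 + τ i - (i : ℝ) / 2) :
    0 ≤ ((m * n : ℕ) : ℝ) / 2 + ∑ i, τ i := by
  have h : 0 ≤ ∑ i : Fin m, ((n : ℝ) / 2 + τ i) := Finset.sum_nonneg fun i _ => by
    have := hτ i
    have : (0 : ℝ) ≤ i := Nat.cast_nonneg _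
    linarith
  rw [Finset.sum_add_distrib, Finset.sum_const, Finset.card_univ, Fintype.card_fin,
    nsmul_eq_mul] at h
  push_cast
  linarith

lemma tRieszIGramDen_pos {n m : ℕ} (hmn : m ≤ n) {Sig : Matrix (Fin m) (Fin m) ℝ}
    (hSig : Sig.PosDef) {ρ k ν : ℝ} (hρ : 0 < ρ) (hνk : 0 < ν / 2 + k) {τ : Fin m → ℝ}
    (hτ : ∀ i : Fin m, 0 < (n : ℝ) / 2 + τ i - (i : ℝ) / 2) {U : Matrix (Fin m) (Fin m) ℝ}
    (hUSig : Sig = Uᵀ * U) (hU' : IsUnit U) {F : Matrix (Fin m) (Fin m) ℝ} (hF : F.PosDef) :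
    0 < tRieszIGramDen n m ν k ρ τ Sig U F := by
  have h1 := mvGamma_pos hmn
  have h2 := mvGammaI_pos hτ
  have h3 := hwv_pos τ (posDef_inv_transpose_mul_mul_inv hF hU')
  have h4 := trace_inv_mul_nonneg hF hUSig hU'
  have h5 := half_mul_add_sum_nonneg hτ
  have h6 : 0 < Gamma ((ν + (m * n : ℕ)) / 2 + k + ∑ i, τ i) :=
    Real.Gamma_pos_of_pos (by linarith)
  have h7 := Real.Gamma_pos_of_pos hνk
  have h8 := hSig.det_pos
  rw [tRieszIGramDen]
  positivity

lemma gramDensity_mul_tRieszIGramDen {n m : ℕ} (hmn : m ≤ n) {Sig : Matrix (Fin m) (Fin m) ℝ}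
    (hSig : Sig.PosDef) {ρ k ν : ℝ} (τ : Fin m → ℝ) {U : Matrix (Fin m) (Fin m) ℝ}
    (hU : U.BlockTriangular id) (hUSig : Sig = Uᵀ * U) (hU' : IsUnit U)
    (F : Matrix (Fin m) (Fin m) ℝ) :
    gramDensity n m F * ENNReal.ofReal (tRieszIGramDen n m ν k ρ τ Sig U F) =
      if F.PosDef then
        ENNReal.ofReal
          (Real.Gamma ((ν + (m * n : ℕ)) / 2 + k + ∑ i, τ i) *
              ρ ^ (((m * n : ℕ) : ℝ) / 2 + ∑ i, τ i) /
              (mvGammaI m ((n : ℝ) / 2) τ * Real.Gamma (ν / 2 + k) *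
                Sig.det ^ ((n : ℝ) / 2) * hwv τ Sig) *
            F.det ^ (((n : ℝ) - (m : ℝ) - 1) / 2) *
            (1 + ρ * (Sig⁻¹ * F).trace) ^
              (-(((m * n : ℕ) + ν) / 2 + k + ∑ i, τ i)) *
            hwv τ F)
      else 0 := by
  rw [gramDensity]
  split_ifs with hF
  swap
  · rw [zero_mul]
  have h1 := mvGamma_pos hmn
  have h2 := hF.det_pos
  rw [← ENNReal.ofReal_mul (by positivity), tRieszIGramDen,
    hwv_inv_transpose_mul_mul_inv τ hF hU (hUSig ▸ hSig) hU', ← hUSig, add_comm ν]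
  congr 1
  have hcancel : ∀ a p b c d q w s y h r : ℝ, a ≠ 0 → p ≠ 0 →
      p / a * d * (a * b * c / (p * w * s * y) * q * (h / r)) =
        b * c / (w * s * y * r) * d * q * h := by
    intro a p b c d q w s y h r ha hp
    field_simp
  exact hcancel _ _ _ _ _ _ _ _ _ _ _ h1.ne' (by positivity)

lemma volume_posDef_gram_ne_zero {n m : ℕ} (hmn : m ≤ n) :
    (volume : Measure (Matrix (Fin n) (Fin m) ℝ)) {X | (Xᵀ * X).PosDef} ≠ 0 := by
  have hset : {X : Matrix (Fin n) (Fin m) ℝ | (Xᵀ * X).PosDef} = {X | (Xᵀ * X).det ≠ 0} := by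
    ext X
    have h := posSemidef_conjTranspose_mul_self X
    rw [conjTranspose_eq_transpose_of_trivial] at h
    exact h.posDef_iff_det_ne_zero
  have hopen : IsOpen {X : Matrix (Fin n) (Fin m) ℝ | (Xᵀ * X).det ≠ 0} :=
    isOpen_ne_fun (Continuous.matrix_det (by fun_prop)) continuous_const
  have hpos : (volume : Measure (Matrix (Fin n) (Fin m) ℝ)).IsOpenPosMeasure :=
    inferInstanceAs (volume : Measure (Fin n → Fin m → ℝ)).IsOpenPosMeasure
  rw [hset]
  refine (hopen.measure_pos volume
    ⟨(1 : Matrix (Fin n) (Fin n) ℝ).submatrix id (Fin.castLE hmn), ?_⟩).ne'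
  have hone : ((1 : Matrix (Fin n) (Fin n) ℝ).submatrix id (Fin.castLE hmn))ᵀ *
      (1 : Matrix (Fin n) (Fin n) ℝ).submatrix id (Fin.castLE hmn) = 1 := by
    rw [transpose_submatrix, transpose_one,
      ← submatrix_mul _ _ _ id _ Function.bijective_id, Matrix.one_mul,
      submatrix_one _ (Fin.castLE_injective hmn)]
  rw [Set.mem_ofPred_eq, hone, det_one]
  exact one_ne_zero

/-- if `T ~ MTR^I(ν, k, τ, ρ, 0, I_n, Σ)`, then `F = TᵀT` has the matrix
multivariate c-beta-Riesz type II density with respect to Lebesgue measure on symmetric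
matrices restricted to the positive definite cone. -/
theorem stmt_12 (n m : ℕ) (hm : 1 ≤ m) (hmn : m ≤ n)
    (Sig : Matrix (Fin m) (Fin m) ℝ) (hSig : Sig.PosDef)
    (ρ k ν : ℝ) (hρ : 0 < ρ) (hν : 0 < ν) (hνk : 0 < ν / 2 + k)
    (τ : Fin m → ℝ) (hτ : ∀ i : Fin m, 0 < (n : ℝ) / 2 + τ i - (i : ℝ) / 2)
    (U : Matrix (Fin m) (Fin m) ℝ) (hU : U.BlockTriangular id)
    (hUd : ∀ i, 0 < U i i) (hUSig : Sig = Uᵀ * U)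
    {Ω : Type*} [MeasurableSpace Ω] (P : Measure Ω) [IsProbabilityMeasure P]
    (T : Ω → Matrix (Fin n) (Fin m) ℝ)
    (hT : Measure.map T P =
      volume.withDensity fun t => ENNReal.ofReal (tRieszIDen n m ν k ρ τ 0 1 Sig U t)) :
    Measure.map (fun ω => (T ω)ᵀ * T ω) P =
      (symmVol m).withDensity fun F =>
        if F.PosDef then
          ENNReal.ofReal
            (Real.Gamma ((ν + (m * n : ℕ)) / 2 + k + ∑ i, τ i) *
                ρ ^ (((m * n : ℕ) : ℝ) / 2 + ∑ i, τ i) /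
                (mvGammaI m ((n : ℝ) / 2) τ * Real.Gamma (ν / 2 + k) *
                  Sig.det ^ ((n : ℝ) / 2) * hwv τ Sig) *
              F.det ^ (((n : ℝ) - (m : ℝ) - 1) / 2) *
              (1 + ρ * (Sig⁻¹ * F).trace) ^
                (-(((m * n : ℕ) + ν) / 2 + k + ∑ i, τ i)) *
              hwv τ F)
        else 0 := by
  have hU' : IsUnit U := by
    refine (isUnit_iff_isUnit_det U).2 (isUnit_iff_ne_zero.2 fun h => hSig.det_pos.ne' ?_)
    rw [hUSig, det_mul, h, mul_zero]
  have hφ : Measurable fun X : Matrix (Fin n) (Fin m) ℝ => Xᵀ * X :=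
    Continuous.measurable (by fun_prop)
  have hh : Measurable fun F => ENNReal.ofReal (tRieszIGramDen n m ν k ρ τ Sig U F) :=
    (measurable_tRieszIGramDen n m ν k ρ τ Sig U).ennreal_ofReal
  have hhφ : Measurable fun X : Matrix (Fin n) (Fin m) ℝ =>
      ENNReal.ofReal (tRieszIGramDen n m ν k ρ τ Sig U (Xᵀ * X)) := hh.comp hφ
  simp_rw [tRieszIDen_zero_one] at hT
  have hTm : AEMeasurable T P := by
    by_contra hTm
    rw [Measure.map_of_not_aemeasurable hTm, eq_comm,
      withDensity_eq_zero_iff hhφ.aemeasurable] at hT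
    refine volume_posDef_gram_ne_zero hmn (measure_mono_null (fun X hX => ?_) hT)
    simpa using tRieszIGramDen_pos hmn hSig hρ hνk hτ hUSig hU' hX
  have hcomp : Measure.map (fun ω => (T ω)ᵀ * T ω) P =
      Measure.map (fun X : Matrix (Fin n) (Fin m) ℝ => Xᵀ * X) (Measure.map T P) :=
    (AEMeasurable.map_map_of_aemeasurable hφ.aemeasurable hTm).symm
  simp_rw [← gramDensity_mul_tRieszIGramDen hmn hSig τ hU hUSig hU']
  rw [hcomp, hT]
  refine Measure.ext_of_lintegral _ fun g hg => ?_
  have hgφ : Measurable fun X : Matrix (Fin n) (Fin m) ℝ => g (Xᵀ * X) := hg.comp hφ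
  rw [lintegral_map hg hφ, lintegral_withDensity_eq_lintegral_mul _ hhφ hgφ,
    lintegral_withDensity_eq_lintegral_mul _ (f := fun F => gramDensity n m F *
      ENNReal.ofReal (tRieszIGramDen n m ν k ρ τ Sig U F)) ((measurable_gramDensity n m).mul hh) hg]
  refine (lintegral_gram hmn (hh.mul hg)).trans (lintegral_congr fun F => ?_)
  exact (mul_assoc _ _ _).symm
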